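/- Let (X,d,φ) be a mixing Smale space such that Λ_X = max{Lip(φ), Lip(φ^{-1})} < ∞. Suppose there exist constants A > 0 and ε₀ > 0 such that whenever d(x,y) ≤ ε₀ one has d(x,[x,y]) ≤ A·d(x,y) and d(y,[x,y]) ≤ A·d(x,y), and suppose λ_X > 2A. Then the Hausdorff dimension of (X,d) satisfies 2·h(φ)/log(Λ_X) ≤ dim_H X ≤ 2·h(φ)/(log(λ_X) − log(2A)). -/

import Mathlib

open Set Metric MeasureTheory Topology
open scoped ENNReal NNReal

/-- A dynamical system is irreducible if for every ordered pair of nonempty open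
sets `U, V` there is `n : ℕ` with `ψ^[n] '' U ∩ V ≠ ∅`. -/
def IrreducibleSystem {Z : Type*} [TopologicalSpace Z] (ψ : Z → Z) : Prop :=
  ∀ U V : Set Z, IsOpen U → IsOpen V → U.Nonempty → V.Nonempty →
    ∃ n : ℕ, (ψ^[n] '' U ∩ V).Nonempty

/-- A dynamical system is mixing if for every ordered pair of nonempty open sets
`U, V` there is `N : ℕ` with `ψ^[n] '' U ∩ V ≠ ∅` for all `n ≥ N`. -/
def MixingSystem {Z : Type*} [TopologicalSpace Z] (ψ : Z → Z) : Prop :=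
  ∀ U V : Set Z, IsOpen U → IsOpen V → U.Nonempty → V.Nonempty →
    ∃ N : ℕ, ∀ n ≥ N, (ψ^[n] '' U ∩ V).Nonempty

/-- The (possibly infinite) Lipschitz constant of a map between metric spaces. -/
noncomputable def lipConst {X : Type*} [PseudoEMetricSpace X] (f : X → X) : ℝ≥0∞ :=
  sInf {K : ℝ≥0∞ | ∀ x y : X, edist (f x) (f y) ≤ K * edist x y}

/-- A measure on a metric space is Ahlfors `s`-regular if closed balls of radius
`r < diam Z` have measure comparable to `r ^ s`. -/
def AhlforsRegular {Z : Type*} [MetricSpace Z] [MeasurableSpace Z]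
    (μ : Measure Z) (s : ℝ) : Prop :=
  0 < s ∧ ∃ C : ℝ, 0 < C ∧ ∀ (z : Z) (r : ℝ), 0 ≤ r → r < diam (Set.univ : Set Z) →
    ENNReal.ofReal (C⁻¹ * r ^ s) ≤ μ (closedBall z r) ∧
    μ (closedBall z r) ≤ ENNReal.ofReal (C * r ^ s)

/-- A Smale space: a compact metric space together with a homeomorphism `phi`,
constants `eps > 0`, `lam > 1` and a partially defined continuous bracket map
satisfying the bracket axioms and the contraction axioms. -/
structure SmaleSpace (X : Type*) [MetricSpace X] where
  phi : Equiv.Perm X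
  phi_cont : Continuous phi
  phi_symm_cont : Continuous phi.symm
  eps : ℝ
  lam : ℝ
  eps_pos : 0 < eps
  one_lt_lam : 1 < lam
  bracket : X → X → X
  bracket_cont : ContinuousOn (fun p : X × X => bracket p.1 p.2)
    {p : X × X | dist p.1 p.2 ≤ eps}
  bracket_self : ∀ x : X, bracket x x = x
  bracket_assoc₁ : ∀ x y z : X, dist y z ≤ eps → dist x (bracket y z) ≤ eps →
    dist x z ≤ eps → bracket x (bracket y z) = bracket x z
  bracket_assoc₂ : ∀ x y z : X, dist x y ≤ eps → dist (bracket x y) z ≤ eps →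
    dist x z ≤ eps → bracket (bracket x y) z = bracket x z
  bracket_phi : ∀ x y : X, dist x y ≤ eps → dist (phi x) (phi y) ≤ eps →
    phi (bracket x y) = bracket (phi x) (phi y)
  contract_s : ∀ (x : X) (ε : ℝ), 0 < ε → ε ≤ eps → ∀ y z : X,
    dist x y < ε → bracket x y = y → dist x z < ε → bracket x z = z →
    dist (phi y) (phi z) ≤ lam⁻¹ * dist y z
  contract_u : ∀ (x : X) (ε : ℝ), 0 < ε → ε ≤ eps → ∀ y z : X,
    dist x y < ε → bracket y x = y → dist x z < ε → bracket z x = z →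
    dist (phi.symm y) (phi.symm z) ≤ lam⁻¹ * dist y z

namespace SmaleSpace

variable {X : Type*} [MetricSpace X] (S : SmaleSpace X)

/-- The local stable set `X^s(x, ε)`. -/
def stable (x : X) (ε : ℝ) : Set X := {y | dist x y < ε ∧ S.bracket x y = y}

/-- The local unstable set `X^u(x, ε)`. -/
def unstable (x : X) (ε : ℝ) : Set X := {y | dist x y < ε ∧ S.bracket y x = y}

/-- A rectangle (relative to the constant `ε'`): a nonempty set of diameter at
most `ε'` closed under the bracket. -/
def IsRectangle (ε' : ℝ) (R : Set X) : Prop :=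
  R.Nonempty ∧ diam R ≤ ε' ∧ ∀ x ∈ R, ∀ y ∈ R, S.bracket x y ∈ R

/-- A proper rectangle: a closed rectangle equal to the closure of its interior. -/
def IsProperRectangle (ε' : ℝ) (R : Set X) : Prop :=
  S.IsRectangle ε' R ∧ IsClosed R ∧ R = closure (interior R)

/-- `X^s(x, R) = X^s(x, 2ε') ∩ R`. -/
def stableIn (ε' : ℝ) (x : X) (R : Set X) : Set X := S.stable x (2 * ε') ∩ R

/-- `X^u(x, R) = X^u(x, 2ε') ∩ R`. -/
def unstableIn (ε' : ℝ) (x : X) (R : Set X) : Set X := S.unstable x (2 * ε') ∩ R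

/-- A Markov partition: a finite cover by nonempty proper rectangles with
pairwise disjoint interiors, satisfying the Markov conditions. -/
def IsMarkovPartition (ε' : ℝ) (P : Set (Set X)) : Prop :=
  P.Finite ∧ ⋃₀ P = Set.univ ∧
  (∀ R ∈ P, S.IsProperRectangle ε' R) ∧
  (∀ R ∈ P, ∀ R' ∈ P, R ≠ R' → interior R ∩ interior R' = ∅) ∧
  (∀ R ∈ P, ∀ R' ∈ P, ∀ x : X, x ∈ interior R → S.phi x ∈ interior R' →
    S.unstableIn ε' (S.phi x) R' ⊆ S.phi '' (S.unstableIn ε' x R) ∧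
    S.phi '' (S.stableIn ε' x R) ⊆ S.stableIn ε' (S.phi x) R')

/-- The refining sequence of Markov partitions
`ℛ_n = {⋂_{i=1-n}^{n-1} φ^{-i}(R_{x_i}) : R_{x_i} ∈ ℛ₁, int ≠ ∅}`, with
`ℛ₀ = {X}`. -/
def markovSeq (P : Set (Set X)) : ℕ → Set (Set X)
  | 0 => {Set.univ}
  | (n + 1) => {R | (interior R).Nonempty ∧ ∃ g : ℤ → Set X, (∀ i : ℤ, g i ∈ P) ∧
      R = ⋂ i ∈ Finset.Icc (-(n : ℤ)) (n : ℤ), (⇑(S.phi ^ i)) ⁻¹' (g i)}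

end SmaleSpace

/-- `N_𝒰(Y)`: the elements of the cover `𝒰` meeting the set `Y`. -/
def nbr {X : Type*} (U : Set (Set X)) (Y : Set X) : Set (Set X) :=
  {u ∈ U | (u ∩ Y).Nonempty}

/-- The property defining the constant `ε'_X` of a Smale space. -/
def SmaleSpace.epsOne {X : Type*} [MetricSpace X] (S : SmaleSpace X) (ε' : ℝ) : Prop :=
  0 < ε' ∧ ε' ≤ S.eps / 2 ∧ ∀ x y : X, dist x y ≤ ε' →
    dist x (S.bracket x y) < S.eps / 2 ∧ dist y (S.bracket x y) < S.eps / 2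

/-- The property defining the constant `ε''_X` of a Smale space. -/
def SmaleSpace.epsTwo {X : Type*} [MetricSpace X] (S : SmaleSpace X) (ε' ε'' : ℝ) : Prop :=
  0 < ε'' ∧ ε'' < ε' / 12 ∧ ∀ x y : X, dist x y ≤ ε'' →
    (∀ i : ℤ, |i| ≤ 2 → dist ((S.phi ^ i) x) ((S.phi ^ i) y) ≤ ε' / 2) ∧
    dist (S.bracket x y) x ≤ ε' / 4 ∧ dist (S.bracket x y) y ≤ ε' / 4

open Set Metric Topology MeasureTheory
open scoped ENNReal

namespace SmaleSpace

section Geometry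

variable {X : Type*} [MetricSpace X] (S : SmaleSpace X)

/-- The inverse Smale space. -/
def inverse : SmaleSpace X where
  phi := S.phi.symm
  phi_cont := S.phi_symm_cont
  phi_symm_cont := by simpa using S.phi_cont
  eps := S.eps
  lam := S.lam
  eps_pos := S.eps_pos
  one_lt_lam := S.one_lt_lam
  bracket := fun x y => S.bracket y x
  bracket_cont := by
    have h := S.bracket_cont.comp (f := fun p : X × X => (p.2, p.1))
      (s := {p : X × X | dist p.1 p.2 ≤ S.eps}) (by fun_prop)
      (by intro p hp; simpa [dist_comm] using hp)
    exact h
  bracket_self := S.bracket_self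
  bracket_assoc₁ := by
    intro x y z h1 h2 h3
    rw [dist_comm] at h1 h2 h3
    exact S.bracket_assoc₂ z y x h1 h2 h3
  bracket_assoc₂ := by
    intro x y z h1 h2 h3
    rw [dist_comm] at h1 h2 h3
    exact S.bracket_assoc₁ z y x h1 h2 h3
  bracket_phi := by
    intro x y h1 h2
    rw [dist_comm] at h1 h2
    rw [Equiv.symm_apply_eq, S.bracket_phi _ _ h2 (by simpa using h1)]
    simp
  contract_s := by
    intro x ε h1 h2 y z h3 h4 h5 h6
    exact S.contract_u x ε h1 h2 y z h3 h4 h5 h6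
  contract_u := by
    intro x ε h1 h2 y z h3 h4 h5 h6
    simpa using S.contract_s x ε h1 h2 y z h3 h4 h5 h6

lemma lam_inv_nonneg : 0 ≤ S.lam⁻¹ := inv_nonneg.2 (by linarith [S.one_lt_lam])

lemma lam_inv_le_one : S.lam⁻¹ ≤ 1 := inv_le_one_of_one_le₀ S.one_lt_lam.le

lemma stable_iter {x z : X} (hd : dist x z < S.eps) (hb : S.bracket x z = z) (n : ℕ) :
    S.bracket (S.phi^[n] x) (S.phi^[n] z) = S.phi^[n] z ∧
      dist (S.phi^[n] x) (S.phi^[n] z) ≤ S.lam⁻¹ ^ n * dist x z := by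
  induction n with
  | zero => simp [hb]
  | succ n ih =>
    obtain ⟨ih1, ih2⟩ := ih
    have hlt : dist (S.phi^[n] x) (S.phi^[n] z) < S.eps := by
      refine lt_of_le_of_lt (ih2.trans ?_) hd
      exact mul_le_of_le_one_left dist_nonneg
        (pow_le_one₀ S.lam_inv_nonneg S.lam_inv_le_one)
    have hc := S.contract_s (S.phi^[n] x) S.eps S.eps_pos le_rfl (S.phi^[n] x) (S.phi^[n] z)
      (by simpa using S.eps_pos) (S.bracket_self _) hlt ih1
    have hc' : dist (S.phi (S.phi^[n] x)) (S.phi (S.phi^[n] z)) ≤ S.eps :=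
      hc.trans ((mul_le_of_le_one_left dist_nonneg S.lam_inv_le_one).trans hlt.le)
    rw [Function.iterate_succ_apply', Function.iterate_succ_apply']
    refine ⟨?_, ?_⟩
    · rw [← S.bracket_phi _ _ hlt.le hc', ih1]
    · refine hc.trans ?_
      rw [pow_succ', mul_assoc]
      exact mul_le_mul_of_nonneg_left ih2 S.lam_inv_nonneg

lemma bracket_stable {x y : X} (h1 : dist x y ≤ S.eps) (h2 : dist x (S.bracket x y) < S.eps)
    (n : ℕ) : dist (S.phi^[n] x) (S.phi^[n] (S.bracket x y)) ≤
      S.lam⁻¹ ^ n * dist x (S.bracket x y) :=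
  (S.stable_iter h2 (S.bracket_assoc₁ x x y h1 h2.le h1) n).2

lemma bracket_unstable {x y : X} (h1 : dist x y ≤ S.eps) (h2 : dist y (S.bracket x y) < S.eps)
    (n : ℕ) : dist (S.phi.symm^[n] y) (S.phi.symm^[n] (S.bracket x y)) ≤
      S.lam⁻¹ ^ n * dist y (S.bracket x y) :=
  S.inverse.bracket_stable (x := y) (y := x) (by rw [dist_comm]; exact h1) h2 n

lemma symm_iter (n : ℕ) (x : X) : S.phi.symm^[n] (S.phi^[n] x) = x :=
  (Function.LeftInverse.iterate S.phi.symm_apply_apply n) x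

lemma iter_symm (n : ℕ) (x : X) : S.phi^[n] (S.phi.symm^[n] x) = x :=
  (Function.LeftInverse.iterate S.phi.apply_symm_apply n) x

lemma symm_iter_add (m n : ℕ) (x : X) : S.phi.symm^[m] (S.phi^[m + n] x) = S.phi^[n] x := by
  rw [Function.iterate_add_apply, symm_iter]

/-- quantitative control of the bracket at scale `ρ` -/
def Ctrl (A ρ : ℝ) : Prop :=
  1 ≤ A ∧ 0 < ρ ∧ ρ ≤ S.eps ∧ A * ρ < S.eps ∧ ∀ x y : X, dist x y ≤ ρ →
    dist x (S.bracket x y) ≤ A * dist x y ∧ dist y (S.bracket x y) ≤ A * dist x y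

variable {S} {A ρ : ℝ}

lemma Ctrl.fwd (hC : S.Ctrl A ρ) {x y : X} {δ : ℝ} (hδ : δ ≤ ρ) (h : dist x y ≤ δ) (n : ℕ) :
    dist (S.phi^[n] x) (S.phi^[n] (S.bracket x y)) ≤ S.lam⁻¹ ^ n * (A * δ) := by
  obtain ⟨hA, hρ, hρe, hAρ, hb⟩ := hC
  have h3 := (hb x y (h.trans hδ)).1
  have h4 : A * dist x y ≤ A * δ := mul_le_mul_of_nonneg_left h (by linarith)
  have h5 : A * δ ≤ A * ρ := mul_le_mul_of_nonneg_left hδ (by linarith)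
  refine (S.bracket_stable (by linarith) (by linarith) n).trans ?_
  exact mul_le_mul_of_nonneg_left (by linarith) (pow_nonneg S.lam_inv_nonneg n)

lemma Ctrl.bwd (hC : S.Ctrl A ρ) {x y : X} {δ : ℝ} (hδ : δ ≤ ρ) (h : dist x y ≤ δ) (n : ℕ) :
    dist (S.phi.symm^[n] y) (S.phi.symm^[n] (S.bracket x y)) ≤ S.lam⁻¹ ^ n * (A * δ) := by
  obtain ⟨hA, hρ, hρe, hAρ, hb⟩ := hC
  have h3 := (hb x y (h.trans hδ)).2
  have h4 : A * dist x y ≤ A * δ := mul_le_mul_of_nonneg_left h (by linarith)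
  have h5 : A * δ ≤ A * ρ := mul_le_mul_of_nonneg_left hδ (by linarith)
  refine (S.bracket_unstable (by linarith) (by linarith) n).trans ?_
  exact mul_le_mul_of_nonneg_left (by linarith) (pow_nonneg S.lam_inv_nonneg n)

lemma Ctrl.expansive (hC : S.Ctrl A ρ) {x y : X} {δ : ℝ} (hδ : δ ≤ ρ) (k : ℕ)
    (h : ∀ j ≤ 2 * k, dist (S.phi^[j] x) (S.phi^[j] y) ≤ δ) :
    dist (S.phi^[k] x) (S.phi^[k] y) ≤ 2 * A * δ * S.lam⁻¹ ^ k := by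
  have hρe := hC.2.2.1
  have hcomm : ∀ j ≤ 2 * k, S.phi^[j] (S.bracket x y) =
      S.bracket (S.phi^[j] x) (S.phi^[j] y) := by
    intro j
    induction j with
    | zero => simp
    | succ j ih =>
      intro hj
      have h1 := h j (by omega)
      have h2 := h (j + 1) hj
      rw [Function.iterate_succ_apply', Function.iterate_succ_apply'] at h2
      rw [Function.iterate_succ_apply', Function.iterate_succ_apply',
        Function.iterate_succ_apply', ih (by omega),
        S.bracket_phi _ _ (by linarith) (by linarith)]
  have h1 := hC.fwd hδ (h 0 (by omega)) k
  have h2 := hC.bwd hδ (h (2 * k) le_rfl) k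
  rw [← hcomm _ le_rfl, two_mul, symm_iter_add, symm_iter_add] at h2
  simp only [Function.iterate_zero, id_eq] at h1
  have := dist_triangle_right (S.phi^[k] x) (S.phi^[k] y) (S.phi^[k] (S.bracket x y))
  linarith

lemma mixing_uniform [CompactSpace X] (S : SmaleSpace X) (hmix : MixingSystem ⇑S.phi)
    {ρ : ℝ} (hρ : 0 < ρ) :
    ∃ M : ℕ, ∀ x y : X, ∃ p, dist p x < ρ ∧ dist (S.phi^[M] p) y < ρ := by
  obtain ⟨t, ht, hcov⟩ := (isCompact_univ (X := X)).finite_cover_balls (half_pos hρ)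
  have hN : ∀ a b : X, ∃ N : ℕ, ∀ n ≥ N,
      (S.phi^[n] '' (ball a (ρ / 2)) ∩ ball b (ρ / 2)).Nonempty := fun a b =>
    hmix _ _ isOpen_ball isOpen_ball ⟨a, mem_ball_self (half_pos hρ)⟩
      ⟨b, mem_ball_self (half_pos hρ)⟩
  choose N hN using hN
  obtain ⟨hf, ht2⟩ := hcov
  have hfin : (t ×ˢ t).Finite := hf.prod hf
  refine ⟨hfin.toFinset.sup fun p => N p.1 p.2, fun x y => ?_⟩
  obtain ⟨a, ha, hxa⟩ := mem_iUnion₂.1 (ht2 (mem_univ x))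
  obtain ⟨b, hb, hyb⟩ := mem_iUnion₂.1 (ht2 (mem_univ y))
  obtain ⟨_, ⟨p, hp, rfl⟩, hq⟩ := hN a b (hfin.toFinset.sup fun p => N p.1 p.2)
    (Finset.le_sup (f := fun p : X × X => N p.1 p.2) (b := (a, b))
      (by simp [ha, hb]))
  refine ⟨p, ?_, ?_⟩
  · rw [mem_ball] at hp hxa
    linarith [dist_triangle_right p x a]
  · rw [mem_ball] at hq hyb
    linarith [dist_triangle_right (S.phi^[hfin.toFinset.sup fun p => N p.1 p.2] p) y b]

lemma Ctrl.glue [CompactSpace X] (hC : S.Ctrl A ρ) (hmix : MixingSystem ⇑S.phi)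
    {η : ℝ} (hη : 0 < η) :
    ∃ M : ℕ, ∀ (a : ℕ) (x y : X), ∃ w, (∀ i ≤ a, dist (S.phi^[i] w) (S.phi^[i] x) ≤ η) ∧
      ∀ i, dist (S.phi^[a + M + i] w) (S.phi^[i] y) ≤ η := by
  have hA := hC.1
  have hρ := hC.2.1
  obtain ⟨r, hr, hr1, hr2⟩ : ∃ r > 0, (A + 1) * r ≤ ρ ∧ A * (A + 2) * r ≤ η := by
    refine ⟨min (ρ / (A + 1)) (η / (A * (A + 2))), by positivity, ?_, ?_⟩
    · rw [← le_div_iff₀' (by positivity)]; exact min_le_left _ _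
    · rw [← le_div_iff₀' (by positivity)]; exact min_le_right _ _
  obtain ⟨M, hM⟩ := S.mixing_uniform hmix hr
  have hpow : ∀ n : ℕ, ∀ c : ℝ, 0 ≤ c → S.lam⁻¹ ^ n * c ≤ c := fun n c hc =>
    mul_le_of_le_one_left hc (pow_le_one₀ S.lam_inv_nonneg S.lam_inv_le_one)
  refine ⟨M, fun a x y => ?_⟩
  obtain ⟨p, hp1, hp2⟩ := hM (S.phi^[a] x) y
  have hrρ : r ≤ ρ := by nlinarith
  set q := S.bracket p (S.phi^[a] x) with hq
  have f1 := hC.fwd hrρ hp1.le M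
  have b1 := hC.bwd hrρ hp1.le
  rw [← hq] at f1
  simp only [← hq] at b1
  have f1' := f1.trans (hpow M (A * r) (by positivity))
  have hy : dist y (S.phi^[M] q) ≤ (A + 1) * r := by
    have h1 := dist_triangle y (S.phi^[M] p) (S.phi^[M] q)
    rw [dist_comm y (S.phi^[M] p)] at h1
    linarith
  set z := S.bracket y (S.phi^[M] q) with hz
  have f2 := hC.fwd hr1 hy
  have b2 := hC.bwd hr1 hy
  simp only [← hz] at f2 b2
  refine ⟨S.phi.symm^[a + M] z, fun i hi => ?_, fun i => ?_⟩
  · have e1 : S.phi^[i] (S.phi.symm^[a + M] z) = S.phi.symm^[(a - i) + M] z := by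
      have : a + M = i + ((a - i) + M) := by omega
      rw [this, Function.iterate_add_apply, iter_symm]
    have e2 : S.phi^[i] x = S.phi.symm^[a - i] (S.phi^[a] x) := by
      have : S.phi^[a] x = S.phi^[(a - i) + i] x := by congr 1; congr 1; omega
      rw [this, symm_iter_add]
    have e3 : S.phi.symm^[(a - i) + M] (S.phi^[M] q) = S.phi.symm^[a - i] q := by
      rw [Function.iterate_add_apply, symm_iter]
    rw [e1, e2]
    have h1 := (b2 ((a - i) + M)).trans (hpow _ _ (by positivity))
    have h2 := (b1 (a - i)).trans (hpow _ _ (by positivity))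
    rw [e3, dist_comm] at h1
    rw [dist_comm] at h2
    have := dist_triangle (S.phi.symm^[a - i + M] z) (S.phi.symm^[a - i] q)
      (S.phi.symm^[a - i] (S.phi^[a] x))
    nlinarith
  · have e1 : S.phi^[a + M + i] (S.phi.symm^[a + M] z) = S.phi^[i] z := by
      rw [add_comm (a + M) i, Function.iterate_add_apply, iter_symm]
    rw [e1, dist_comm]
    have h1 := (f2 i).trans (hpow _ _ (by positivity))
    have : 0 ≤ A * r := by positivity
    nlinarith

end Geometry

end SmaleSpace

section Counting

variable {X : Type*} [MetricSpace X]

/-- closeness along an orbit segment -/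
def OrbClose (f : X → X) (δ : ℝ) (n : ℕ) (x y : X) : Prop :=
  ∀ i < n, dist (f^[i] x) (f^[i] y) < δ

/-- separated sets -/
def OrbSep (f : X → X) (δ : ℝ) (n : ℕ) (E : Finset X) : Prop :=
  ∀ x ∈ E, ∀ y ∈ E, OrbClose f δ n x y → x = y

lemma OrbClose.symm' {f : X → X} {δ : ℝ} {n : ℕ} {x y : X} (h : OrbClose f δ n x y) :
    OrbClose f δ n y x := fun i hi => by rw [dist_comm]; exact h i hi

lemma exists_dyn_cover_card (f : X → X) (F : Set X) (U : SetRel X X) (n : ℕ)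
    (h : Dynamics.coverMincard f F U n < ⊤) :
    ∃ s : Finset X, Dynamics.IsDynCoverOf f F U n s ∧
      (s.card : ℕ∞) = Dynamics.coverMincard f F U n :=
  (Dynamics.coverMincard_finite_iff f F U n).1 h

lemma exists_max_orbSep [CompactSpace X] {f : X → X} (hf : Continuous f) {δ : ℝ} (hδ : 0 < δ)
    (n : ℕ) : ∃ E : Finset X, OrbSep f δ n E ∧
      (∀ E' : Finset X, OrbSep f δ n E' → E'.card ≤ E.card) ∧
      ∀ x, ∃ e ∈ E, OrbClose f δ n x e := by
  classical
  obtain ⟨s, hs⟩ := Dynamics.exists_isDynCoverOf_of_isCompact_uniformContinuous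
    (isCompact_univ (X := X)) (CompactSpace.uniformContinuous_of_continuous hf)
    (Metric.dist_mem_uniformity (half_pos hδ)) n
  have hs' : ∀ x, ∃ y ∈ s, OrbClose f (δ / 2) n x y := by
    intro x
    obtain ⟨y, hy, hxy⟩ := hs (mem_univ x)
    refine ⟨y, hy, fun i hi => ?_⟩
    exact Dynamics.mem_dynEntourage.1 hxy i hi
  choose g hgs hg using hs'
  have hbound : ∀ E' : Finset X, OrbSep f δ n E' → E'.card ≤ s.card := by
    intro E' hE'
    refine Finset.card_le_card_of_injOn g (fun x _ => hgs x) ?_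
    intro x hx y hy hxy
    refine hE' x hx y hy fun i hi => ?_
    have h1 := hg x i hi
    have h2 := hg y i hi
    rw [← hxy] at h2
    linarith [dist_triangle_right (f^[i] x) (f^[i] y) (f^[i] (g x))]
  let K : Set ℕ := {k | ∃ E : Finset X, OrbSep f δ n E ∧ E.card = k}
  have hne : K.Nonempty := ⟨0, ∅, by simp [OrbSep], by simp⟩
  have hbd : BddAbove K := ⟨s.card, by rintro _ ⟨E, hE, rfl⟩; exact hbound E hE⟩
  obtain ⟨E, hE, hcard⟩ := Nat.sSup_mem hne hbd
  have hmax : ∀ E' : Finset X, OrbSep f δ n E' → E'.card ≤ E.card := by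
    intro E' hE'
    rw [hcard]
    exact le_csSup hbd ⟨E', hE', rfl⟩
  refine ⟨E, hE, hmax, fun x => ?_⟩
  by_contra! hcon
  have hx : x ∉ E := fun hx => hcon x hx fun i _ => by simpa using hδ
  have : OrbSep f δ n (insert x E) := by
    intro a ha b hb hab
    rcases Finset.mem_insert.1 ha with rfl | ha' <;> rcases Finset.mem_insert.1 hb with rfl | hb'
    · rfl
    · exact absurd hab (hcon b hb')
    · exact absurd hab.symm' (hcon a ha')
    · exact hE a ha' b hb' hab
  have := hmax _ this
  rw [Finset.card_insert_of_notMem hx] at this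
  omega

lemma orbSep_glue {f : X → X} {η δ : ℝ} {M : ℕ} (hηδ : 0 < δ - 2 * η)
    (hM : ∀ (a : ℕ) (x y : X), ∃ w, (∀ i ≤ a, dist (f^[i] w) (f^[i] x) ≤ η) ∧
      ∀ i, dist (f^[a + M + i] w) (f^[i] y) ≤ η) {a b : ℕ} {E₁ E₂ : Finset X}
    (h₁ : OrbSep f δ a E₁) (h₂ : OrbSep f δ b E₂) :
    ∃ E : Finset X, OrbSep f (δ - 2 * η) (a + M + b) E ∧ E.card = E₁.card * E₂.card := by
  classical
  choose w hw1 hw2 using hM a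
  have key : ∀ x ∈ E₁, ∀ y ∈ E₂, ∀ x' ∈ E₁, ∀ y' ∈ E₂,
      OrbClose f (δ - 2 * η) (a + M + b) (w x y) (w x' y') → x = x' ∧ y = y' := by
    intro x hx y hy x' hx' y' hy' hcl
    constructor
    · refine h₁ x hx x' hx' fun i hi => ?_
      have t1 := hw1 x y i hi.le
      have t2 := hw1 x' y' i hi.le
      have t3 := hcl i (by omega)
      rw [dist_comm] at t1
      linarith [dist_triangle4 (f^[i] x) (f^[i] (w x y)) (f^[i] (w x' y')) (f^[i] x')]
    · refine h₂ y hy y' hy' fun i hi => ?_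
      have t1 := hw2 x y i
      have t2 := hw2 x' y' i
      have t3 := hcl (a + M + i) (by omega)
      rw [dist_comm] at t1
      linarith [dist_triangle4 (f^[i] y) (f^[a + M + i] (w x y)) (f^[a + M + i] (w x' y'))
        (f^[i] y')]
  refine ⟨(E₁ ×ˢ E₂).image fun p => w p.1 p.2, ?_, ?_⟩
  · intro u hu v hv huv
    obtain ⟨p, hp, rfl⟩ := Finset.mem_image.1 hu
    obtain ⟨q, hq, rfl⟩ := Finset.mem_image.1 hv
    rw [Finset.mem_product] at hp hq
    obtain ⟨e1, e2⟩ := key _ hp.1 _ hp.2 _ hq.1 _ hq.2 huv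
    simp only [e1, e2]
  · rw [Finset.card_image_of_injOn, Finset.card_product]
    intro p hp q hq hpq
    rw [Finset.mem_coe, Finset.mem_product] at hp hq
    obtain ⟨e1, e2⟩ := key _ hp.1 _ hp.2 _ hq.1 _ hq.2
      (fun i _ => by simp only [hpq, dist_self]; exact hηδ)
    exact Prod.ext e1 e2

end Counting

namespace SmaleSpace

variable {X : Type*} [MetricSpace X] {S : SmaleSpace X} {A ρ : ℝ}

lemma Ctrl.exists_k (hC : S.Ctrl A ρ) {δ : ℝ} (hδ : 0 < δ) :
    ∃ k : ℕ, 2 * A * δ * S.lam⁻¹ ^ k < δ / 4 := by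
  have hA := hC.1
  obtain ⟨k, hk⟩ := exists_pow_lt_of_lt_one (x := 1 / (8 * A)) (y := S.lam⁻¹) (by positivity)
    (inv_lt_one_of_one_lt₀ S.one_lt_lam)
  refine ⟨k, ?_⟩
  have : 2 * A * δ * S.lam⁻¹ ^ k < 2 * A * δ * (1 / (8 * A)) :=
    mul_lt_mul_of_pos_left hk (by positivity)
  refine this.trans_eq ?_
  field_simp
  norm_num

lemma Ctrl.sep_shift (hC : S.Ctrl A ρ) {δ : ℝ} (hδρ : δ ≤ ρ) {k : ℕ}
    (hk : 2 * A * δ * S.lam⁻¹ ^ k < δ / 4) {m : ℕ} {F : Finset X}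
    (hF : OrbSep S.phi (δ / 4) m F) :
    ∃ F' : Finset X, OrbSep S.phi δ (m + 2 * k) F' ∧ F'.card = F.card := by
  classical
  refine ⟨F.image S.phi.symm^[k], ?_, ?_⟩
  · intro u hu v hv huv
    obtain ⟨x, hx, rfl⟩ := Finset.mem_image.1 hu
    obtain ⟨y, hy, rfl⟩ := Finset.mem_image.1 hv
    congr 1
    refine hF x hx y hy fun i hi => lt_of_le_of_lt ?_ hk
    have := hC.expansive (x := S.phi^[i] (S.phi.symm^[k] x)) (y := S.phi^[i] (S.phi.symm^[k] y))
      hδρ k (fun j hj => by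
        rw [← Function.iterate_add_apply, ← Function.iterate_add_apply]
        exact (huv (j + i) (by omega)).le)
    rwa [← Function.iterate_add_apply, ← Function.iterate_add_apply, add_comm k i,
      Function.iterate_add_apply, Function.iterate_add_apply, S.iter_symm, S.iter_symm] at this
  · exact Finset.card_image_of_injective _ (S.phi.symm.injective.iterate k)

lemma Ctrl.lower_count [CompactSpace X] [Nonempty X] (hC : S.Ctrl A ρ)
    (hmix : MixingSystem ⇑S.phi)
    {δ : ℝ} (hδ : 0 < δ) (hδρ : δ ≤ ρ) :
    ∃ c : ℕ, ∀ {ι : Type} (t : Finset ι) (B : ι → Set X) (n : ι → ℕ) (P : ι → ℝ),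
      (∀ i ∈ t, c ≤ 2 * n i) → (∀ x : X, ∃ i ∈ t, x ∈ B i) →
      (∀ i ∈ t, ∀ x ∈ B i, ∀ y ∈ B i, ∀ j ≤ n i, dist (S.phi^[j] x) (S.phi^[j] y) < δ / 2 ∧
        dist (S.phi.symm^[j] x) (S.phi.symm^[j] y) < δ / 2) →
      (∀ i ∈ t, 0 < P i ∧ ∃ G : Finset X, OrbSep S.phi δ (2 * n i - c) G ∧ P i ≤ G.card) →
      1 ≤ ∑ i ∈ t, (P i)⁻¹ := by
  classical
  obtain ⟨k, hk⟩ := hC.exists_k hδ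
  obtain ⟨M, hM⟩ := hC.glue hmix (η := δ / 8) (by positivity)
  refine ⟨4 * k + 2 * M, fun {ι} t B n P hcn hcov hB hP => ?_⟩
  set N := t.sup n with hN
  obtain ⟨E, hE, hEmax, hEcov⟩ := exists_max_orbSep S.phi_cont (half_pos hδ) (2 * N)
  have hEpos : (0 : ℝ) < E.card := by
    obtain ⟨e, he, _⟩ := hEcov (Classical.arbitrary X)
    exact_mod_cast Finset.card_pos.2 ⟨e, he⟩
  have main : ∀ i ∈ t, ((E.filter fun e => S.phi^[N] e ∈ B i).card : ℝ) ≤ E.card * (P i)⁻¹ := by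
    intro i hi
    have hnN : n i ≤ N := Finset.le_sup hi
    obtain ⟨F, hF, -, hFcov⟩ := exists_max_orbSep S.phi_cont (δ := δ / 4) (by positivity)
      (N - n i)
    obtain ⟨F', hF', hF'c⟩ := hC.sep_shift hδρ hk hF
    obtain ⟨hPpos, G, hG, hPG⟩ := hP i hi
    obtain ⟨H, hH, hHc⟩ := orbSep_glue (by linarith) hM hG hF'
    have hF'2 : OrbSep S.phi (δ - 2 * (δ / 8)) (N - n i + 2 * k) F' := by
      intro x hx y hy hxy
      exact hF' x hx y hy fun j hj => (hxy j hj).trans (by linarith)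
    obtain ⟨H2, hH2, hH2c⟩ := orbSep_glue (by linarith) hM hF'2 hH
    have hlen : N - n i + 2 * k + M + (2 * n i - (4 * k + 2 * M) + M + (N - n i + 2 * k))
        = 2 * N := by
      have := hcn i hi
      omega
    rw [hlen] at hH2
    have hδ2 : δ - 2 * (δ / 8) - 2 * (δ / 8) = δ / 2 := by ring
    rw [hδ2] at hH2
    have c1 := hEmax H2 hH2
    rw [hH2c, hHc, hF'c] at c1
    choose g hgF hg using hFcov
    have c2 : (E.filter fun e => S.phi^[N] e ∈ B i).card ≤ F.card * F.card := by
      rw [← Finset.card_product]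
      refine Finset.card_le_card_of_injOn (fun e => (g e, g (S.phi^[N + n i] e))) ?_ ?_
      · intro e _
        simp [hgF]
      · intro e he e' he' hee
        rw [Finset.mem_coe, Finset.mem_filter] at he he'
        obtain ⟨h1, h2⟩ := Prod.ext_iff.1 hee
        simp only at h1 h2
        refine hE e he.1 e' he'.1 fun j hj => ?_
        rcases lt_or_ge j (N - n i) with hj1 | hj1
        · have t1 := hg e j hj1
          have t2 := hg e' j hj1
          rw [← h1] at t2
          linarith [dist_triangle_right (S.phi^[j] e) (S.phi^[j] e') (S.phi^[j] (g e))]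
        rcases lt_or_ge j (N + n i) with hj2 | hj2
        · rcases lt_or_ge j N with hj3 | hj3
          · have := (hB i hi _ he.2 _ he'.2 (N - j) (by omega)).2
            have hNj : N = (N - j) + j := by omega
            have e1 : ∀ u, S.phi.symm^[N - j] (S.phi^[N] u) = S.phi^[j] u := by
              intro u
              conv_lhs => rw [show S.phi^[N] u = S.phi^[(N - j) + j] u by rw [← hNj]]
              exact S.symm_iter_add _ _ _
            rwa [e1, e1] at this
          · have := (hB i hi _ he.2 _ he'.2 (j - N) (by omega)).1
            rwa [← Function.iterate_add_apply, ← Function.iterate_add_apply,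
              Nat.sub_add_cancel hj3] at this
        · have t1 := hg (S.phi^[N + n i] e) (j - (N + n i)) (by omega)
          have t2 := hg (S.phi^[N + n i] e') (j - (N + n i)) (by omega)
          rw [← h2] at t2
          rw [← Function.iterate_add_apply, Nat.sub_add_cancel hj2] at t1 t2
          linarith [dist_triangle_right (S.phi^[j] e) (S.phi^[j] e')
            (S.phi^[j - (N + n i)] (g (S.phi^[N + n i] e)))]
    rw [← div_eq_mul_inv, le_div_iff₀ hPpos]
    have c1' : (F.card : ℝ) * (G.card * F.card) ≤ E.card := by exact_mod_cast c1
    have c2' : ((E.filter fun e => S.phi^[N] e ∈ B i).card : ℝ) ≤ F.card * F.card := by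
      exact_mod_cast c2
    calc ((E.filter fun e => S.phi^[N] e ∈ B i).card : ℝ) * P i
        ≤ (F.card * F.card) * G.card := by gcongr
      _ = (F.card : ℝ) * (G.card * F.card) := by ring
      _ ≤ _ := c1'
  have hsum : (E.card : ℝ) ≤ ∑ i ∈ t, ((E.filter fun e => S.phi^[N] e ∈ B i).card : ℝ) := by
    have : E ⊆ t.biUnion fun i => E.filter fun e => S.phi^[N] e ∈ B i := by
      intro e he
      obtain ⟨i, hi, hx⟩ := hcov (S.phi^[N] e)
      exact Finset.mem_biUnion.2 ⟨i, hi, Finset.mem_filter.2 ⟨he, hx⟩⟩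
    exact_mod_cast (Finset.card_le_card this).trans Finset.card_biUnion_le
  have h3 := hsum.trans (Finset.sum_le_sum main)
  rw [← Finset.mul_sum] at h3
  exact (le_mul_iff_one_le_right hEpos).1 h3

end SmaleSpace

section Entropy

variable {X : Type*} [MetricSpace X] [CompactSpace X]

lemma ereal_exp_mul_nat (b : ℝ) (n : ℕ) :
    EReal.exp ((b : EReal) * (n : EReal)) = ENNReal.ofReal (Real.exp (b * n)) := by
  rw [← EReal.exp_coe]
  simp

lemma ent_upper {f : X → X} (hf : Continuous f) {h b δ : ℝ}
    (hent : Dynamics.coverEntropy f Set.univ = (h : EReal)) (hb : h < b) (hδ : 0 < δ) :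
    ∀ᶠ n : ℕ in Filter.atTop, ∃ s : Finset X, (∀ x, ∃ y ∈ s, OrbClose f δ n x y) ∧
      (s.card : ℝ) ≤ Real.exp (b * n) := by
  have hU := Metric.dist_mem_uniformity (α := X) hδ
  have h1 : Dynamics.coverEntropyEntourage f Set.univ {p : X × X | dist p.1 p.2 < δ}
      < (b : EReal) := by
    refine lt_of_le_of_lt (Dynamics.coverEntropyEntourage_le_coverEntropy f Set.univ hU) ?_
    rw [hent]; exact_mod_cast hb
  have h2 := ExpGrowth.eventually_le_exp h1
  filter_upwards [h2] with n hn
  obtain ⟨s, hs, hcard⟩ := exists_dyn_cover_card f Set.univ {p : X × X | dist p.1 p.2 < δ} n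
    (Dynamics.coverMincard_finite_of_isCompact_uniformContinuous isCompact_univ
      (CompactSpace.uniformContinuous_of_continuous hf) hU n)
  refine ⟨s, fun x => ?_, ?_⟩
  · obtain ⟨y, hy, hxy⟩ := hs (mem_univ x)
    exact ⟨y, hy, fun i hi => Dynamics.mem_dynEntourage.1 hxy i hi⟩
  · rw [← hcard, ereal_exp_mul_nat] at hn
    rw [ENat.toENNReal_coe] at hn
    rw [← ENNReal.ofReal_natCast] at hn
    exact (ENNReal.ofReal_le_ofReal_iff (Real.exp_pos _).le).1 hn

lemma ent_lower {f : X → X} (hf : Continuous f) {h b : ℝ}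
    (hent : Dynamics.coverEntropy f Set.univ = (h : EReal)) (hb : b < h) :
    ∃ δ₀ > 0, ∀ δ, 0 < δ → δ ≤ δ₀ → ∀ᶠ n : ℕ in Filter.atTop, ∃ G : Finset X,
      OrbSep f δ n G ∧ Real.exp (b * n) ≤ G.card := by
  rw [← Dynamics.coverEntropyInf_eq_coverEntropy f (mapsTo_univ _ _),
    Dynamics.coverEntropyInf_eq_iSup_basis Metric.uniformity_basis_dist] at hent
  have hb' : (b : EReal) < h := by exact_mod_cast hb
  rw [← hent] at hb'
  obtain ⟨δ₀, hb'⟩ := lt_iSup_iff.1 hb'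
  obtain ⟨hδ₀, hb'⟩ := lt_iSup_iff.1 hb'
  refine ⟨δ₀, hδ₀, fun δ hδ hδδ => ?_⟩
  have h3 : (b : EReal) < Dynamics.coverEntropyInfEntourage f Set.univ
      {p : X × X | dist p.1 p.2 < δ} := by
    refine hb'.trans_le (Dynamics.coverEntropyInfEntourage_antitone f Set.univ ?_)
    intro p hp
    exact lt_of_lt_of_le hp hδδ
  filter_upwards [ExpGrowth.eventually_exp_le h3] with n hn
  obtain ⟨E, hE, -, hcov⟩ := exists_max_orbSep hf hδ n
  refine ⟨E, hE, ?_⟩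
  have hc : Dynamics.IsDynCoverOf f Set.univ {p : X × X | dist p.1 p.2 < δ} n (E : Set X) := by
    intro x _
    obtain ⟨e, he, hxe⟩ := hcov x
    exact ⟨e, he, Dynamics.mem_dynEntourage.2 fun i hi => hxe i hi⟩
  have h4 := hn.trans (ENat.toENNReal_mono hc.coverMincard_le_card)
  rw [ereal_exp_mul_nat, ENat.toENNReal_coe, ← ENNReal.ofReal_natCast] at h4
  exact (ENNReal.ofReal_le_ofReal_iff (Nat.cast_nonneg _)).1 h4

lemma exists_ball_cover [Nonempty X] [MeasurableSpace X] [BorelSpace X] {s : ℝ} (hs : 0 < s)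
    (hμ : μH[s] (Set.univ : Set X) = 0) {κ r₀ : ℝ} (hκ : 0 < κ) (hr₀ : 0 < r₀) :
    ∃ (t : Finset ℕ) (x : ℕ → X) (r : ℕ → ℝ), (∀ i, 0 < r i ∧ r i < r₀) ∧
      (∀ y : X, ∃ i ∈ t, y ∈ ball (x i) (r i)) ∧ ∑ i ∈ t, r i ^ s ≤ κ := by
  rw [Measure.hausdorffMeasure_apply] at hμ
  have h1 : (⨅ (t : ℕ → Set X) (_ : Set.univ ⊆ ⋃ n, t n)
      (_ : ∀ n, ediam (t n) ≤ ENNReal.ofReal (r₀ / 2)),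
      ∑' n, ⨆ _ : (t n).Nonempty, ediam (t n) ^ s) < ENNReal.ofReal (κ / 2) := by
    refine lt_of_le_of_lt ?_ (ENNReal.ofReal_pos.2 (half_pos hκ))
    rw [← hμ]
    exact le_iSup₂ (f := fun (r : ℝ≥0∞) (_ : 0 < r) =>
      ⨅ (t : ℕ → Set X) (_ : Set.univ ⊆ ⋃ n, t n) (_ : ∀ n, ediam (t n) ≤ r),
          ∑' n, ⨆ _ : (t n).Nonempty, ediam (t n) ^ s) (ENNReal.ofReal (r₀ / 2))
      (ENNReal.ofReal_pos.2 (half_pos hr₀))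
  simp only [iInf_lt_iff] at h1
  obtain ⟨t, hcov, hdiam, hsum⟩ := h1
  obtain ⟨e, he, hesum⟩ := (Set.countable_univ (α := ℕ)).exists_pos_forall_sum_le (half_pos hκ)
  set a : ℕ → ℝ≥0∞ := fun n => ⨆ _ : (t n).Nonempty, ediam (t n) ^ s with ha
  have hata : ∀ n, a n ≠ ⊤ := fun n => ENNReal.ne_top_of_tsum_ne_top hsum.ne_top n
  have key : ∀ n, ∃ (x : X) (r : ℝ), 0 < r ∧ r < r₀ ∧ t n ⊆ ball x r ∧
      r ^ s ≤ (a n).toReal + e n := by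
    intro n
    -- choose a radius slightly larger than a given number
    have step : ∀ d : ℝ, 0 ≤ d → d < r₀ → ∃ r, d < r ∧ r < r₀ ∧ r ^ s ≤ d ^ s + e n := by
      intro d hd hdr
      have hc : ContinuousAt (fun r : ℝ => r ^ s) d :=
        Real.continuousAt_rpow_const d s (Or.inr hs.le)
      have h2 : ∀ᶠ r in 𝓝 d, r ^ s < d ^ s + e n :=
        hc.eventually (Iio_mem_nhds (by linarith [he n]))
      have h3 : ∀ᶠ r in 𝓝[>] d, r ^ s < d ^ s + e n ∧ r < r₀ ∧ d < r :=
        (h2.filter_mono nhdsWithin_le_nhds).and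
          (((eventually_lt_nhds hdr).filter_mono nhdsWithin_le_nhds).and
            self_mem_nhdsWithin)
      obtain ⟨r, h4, h5, h6⟩ := h3.exists
      exact ⟨r, h6, h5, h4.le⟩
    rcases (t n).eq_empty_or_nonempty with hem | ⟨x, hx⟩
    · obtain ⟨r, hr1, hr2, hr3⟩ := step 0 le_rfl hr₀
      refine ⟨Classical.arbitrary X, r, hr1, hr2, by simp [hem], hr3.trans ?_⟩
      rw [Real.zero_rpow hs.ne']
      linarith [ENNReal.toReal_nonneg (a := a n)]
    · have hd : diam (t n) ≤ r₀ / 2 := by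
        have := ENNReal.toReal_mono ENNReal.ofReal_ne_top (hdiam n)
        rwa [ENNReal.toReal_ofReal (half_pos hr₀).le] at this
      obtain ⟨r, hr1, hr2, hr3⟩ := step (diam (t n)) diam_nonneg (by linarith)
      refine ⟨x, r, diam_nonneg.trans_lt hr1, hr2, fun y hy => ?_, hr3.trans ?_⟩
      · exact (dist_le_diam_of_mem (isCompact_univ.isBounded.subset (subset_univ _))
          hy hx).trans_lt hr1
      · have : (a n).toReal = diam (t n) ^ s := by
          have hne : (t n).Nonempty := ⟨x, hx⟩
          simp only [ha, hne, ciSup_pos]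
          rw [← ENNReal.toReal_rpow]
          rfl
        rw [this]
  choose x r hr0 hr1 hr2 hr3 using key
  obtain ⟨T, hT⟩ := isCompact_univ.elim_finite_subcover (fun n => ball (x n) (r n))
    (fun n => isOpen_ball) (hcov.trans (iUnion_mono hr2))
  refine ⟨T, x, r, fun i => ⟨hr0 i, hr1 i⟩, fun y => ?_, ?_⟩
  · obtain ⟨i, hi, hy⟩ := mem_iUnion₂.1 (hT (mem_univ y))
    exact ⟨i, hi, hy⟩
  · calc ∑ i ∈ T, r i ^ s ≤ ∑ i ∈ T, ((a i).toReal + e i) := Finset.sum_le_sum fun i _ => hr3 i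
      _ = ∑ i ∈ T, (a i).toReal + ∑ i ∈ T, e i := Finset.sum_add_distrib
      _ ≤ κ / 2 + κ / 2 := by
          refine add_le_add ?_ (hesum T (Set.subset_univ _))
          rw [← ENNReal.toReal_sum fun i _ => hata i]
          refine ENNReal.toReal_le_of_le_ofReal (half_pos hκ).le ?_
          exact (ENNReal.sum_le_tsum T).trans hsum.le
      _ = κ := by ring

end Entropy

namespace SmaleSpace

variable {X : Type*} [MetricSpace X] [CompactSpace X] {S : SmaleSpace X} {A ρ : ℝ}

lemma dist_iter_le {f : X → X} {L : ℝ} (hL : 0 ≤ L) (hf : ∀ x y, dist (f x) (f y) ≤ L * dist x y)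
    (n : ℕ) (x y : X) : dist (f^[n] x) (f^[n] y) ≤ L ^ n * dist x y := by
  induction n with
  | zero => simp
  | succ n ih =>
    rw [Function.iterate_succ_apply', Function.iterate_succ_apply', pow_succ', mul_assoc]
    exact (hf _ _).trans (mul_le_mul_of_nonneg_left ih hL)

lemma Ctrl.lower_dim [Nonempty X] [MeasurableSpace X] [BorelSpace X] (hC : S.Ctrl A ρ)
    (hmix : MixingSystem ⇑S.phi) {h L s : ℝ}
    (hent : Dynamics.coverEntropy ⇑S.phi Set.univ = (h : EReal)) (hL : 1 < L)
    (hf : ∀ x y, dist (S.phi x) (S.phi y) ≤ L * dist x y)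
    (hf' : ∀ x y, dist (S.phi.symm x) (S.phi.symm y) ≤ L * dist x y)
    (hs : 0 < s) (hsh : s * Real.log L / 2 < h) : μH[s] (Set.univ : Set X) ≠ 0 := by
  intro hμ
  set b := s * Real.log L / 2 with hb
  have hL0 : 0 < L := by linarith
  obtain ⟨δ₀, hδ₀, hent2⟩ := ent_lower S.phi_cont hent hsh
  set δ := min δ₀ ρ with hδdef
  have hδ : 0 < δ := lt_min hδ₀ hC.2.1
  obtain ⟨c, hc⟩ := hC.lower_count hmix hδ (min_le_right _ _)
  obtain ⟨n₀, hn₀⟩ := Filter.eventually_atTop.1 (hent2 δ hδ (min_le_left _ _))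
  set C := Real.exp (b * c) * (4 * L / δ) ^ s with hCdef
  have hCpos : 0 < C := by positivity
  obtain ⟨t, x, r, hr, hcov, hsum⟩ := exists_ball_cover hs hμ (κ := 1 / (2 * C))
    (r₀ := δ / (4 * L ^ (c + n₀))) (by positivity) (by positivity)
  have hn : ∀ i, ∃ n : ℕ, L ^ n ≤ δ / (4 * r i) ∧ δ / (4 * r i) < L ^ (n + 1) ∧ c + n₀ ≤ n := by
    intro i
    obtain ⟨h1, h2⟩ := hr i
    have h3 : L ^ (c + n₀) < δ / (4 * r i) := by
      rw [lt_div_iff₀ (by positivity)] at h2 ⊢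
      linarith
    obtain ⟨n, h4, h5⟩ := exists_nat_pow_near ((one_le_pow₀ hL.le).trans h3.le) hL
    refine ⟨n, h4, h5, ?_⟩
    have := (pow_lt_pow_iff_right₀ hL).1 (h3.trans h5)
    omega
  choose n hn1 hn2 hn3 using hn
  have h1 := hc t (fun i => ball (x i) (r i)) n (fun i => Real.exp (b * (2 * n i - c : ℕ)))
    (fun i _ => by have := hn3 i; omega) hcov ?_ ?_
  · have h2 : ∀ i ∈ t, (Real.exp (b * (2 * n i - c : ℕ)))⁻¹ ≤ C * r i ^ s := by
      intro i _
      have hri := (hr i).1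
      have hcn : c ≤ 2 * n i := by have := hn3 i; omega
      rw [Nat.cast_sub hcn, ← Real.exp_neg]
      have e1 : -(b * (((2 * n i : ℕ) : ℝ) - c)) = b * c + Real.log L * n i * (-s) := by
        push_cast; rw [hb]; ring
      rw [e1, Real.exp_add, Real.exp_mul (Real.log L * n i), Real.exp_mul (Real.log L),
        Real.exp_log hL0, Real.rpow_natCast,
        hCdef, mul_assoc]
      refine mul_le_mul_of_nonneg_left ?_ (Real.exp_pos _).le
      rw [← Real.mul_rpow (by positivity) hri.le, Real.rpow_neg (by positivity),
        ← Real.inv_rpow (by positivity)]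
      refine Real.rpow_le_rpow (by positivity) ?_ hs.le
      rw [inv_le_iff_one_le_mul₀ (by positivity)]
      have h5 := hn2 i
      rw [div_lt_iff₀ (by positivity), pow_succ] at h5
      have e2 : 4 * L / δ * r i * L ^ n i = (L ^ n i * L * (4 * r i)) / δ := by ring
      rw [e2, le_div_iff₀ hδ]
      linarith
    have h3 := h1.trans (Finset.sum_le_sum h2)
    rw [← Finset.mul_sum] at h3
    have h4 := h3.trans (mul_le_mul_of_nonneg_left hsum hCpos.le)
    have : C * (1 / (2 * C)) = 1 / 2 := by field_simp
    rw [this] at h4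
    norm_num at h4
  · intro i _ u hu v hv j hj
    have hri := (hr i).1
    have huv : dist u v < 2 * r i := by
      rw [mem_ball] at hu hv
      linarith [dist_triangle_right u v (x i)]
    have hLj : L ^ j * dist u v < δ / 2 := by
      calc L ^ j * dist u v ≤ L ^ n i * dist u v := by
            gcongr
            exact hL.le
        _ < L ^ n i * (2 * r i) := by gcongr
        _ ≤ δ / (4 * r i) * (2 * r i) := by gcongr; exact hn1 i
        _ = δ / 2 := by field_simp; norm_num
    exact ⟨(dist_iter_le hL0.le hf j u v).trans_lt hLj,
      (dist_iter_le hL0.le hf' j u v).trans_lt hLj⟩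
  · intro i _
    refine ⟨Real.exp_pos _, ?_⟩
    exact hn₀ _ (by have := hn3 i; omega)

lemma Ctrl.upper_dim [MeasurableSpace X] [BorelSpace X] (hC : S.Ctrl A ρ)
    {h s : ℝ} (hent : Dynamics.coverEntropy ⇑S.phi Set.univ = (h : EReal))
    (hs : 0 < s) (hsh : h < s * Real.log S.lam / 2) : μH[s] (Set.univ : Set X) ≠ ⊤ := by
  set b := s * Real.log S.lam / 2 with hb
  have hρ := hC.2.1
  have hA := hC.1
  have hlam0 : 0 < S.lam := by linarith [S.one_lt_lam]
  have hli : 0 < S.lam⁻¹ := inv_pos.2 hlam0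
  have h1 := ent_upper S.phi_cont hent hsh (half_pos hρ)
  have h2 : ∀ᶠ n : ℕ in Filter.atTop, ∃ s : Finset X,
      (∀ x, ∃ y ∈ s, OrbClose S.phi (ρ / 2) (2 * n + 1) x y) ∧
      (s.card : ℝ) ≤ Real.exp (b * (2 * n + 1 : ℕ)) := by
    have ht : Filter.Tendsto (fun n : ℕ => 2 * n + 1) Filter.atTop Filter.atTop :=
      Filter.tendsto_atTop_mono (fun n => by simp only [id]; omega) Filter.tendsto_id
    exact ht.eventually h1
  obtain ⟨n₀, hn₀⟩ := Filter.eventually_atTop.1 h2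
  have hn₁ : ∀ n : ℕ, ∃ s : Finset X, n₀ ≤ n →
      (∀ x, ∃ y ∈ s, OrbClose S.phi (ρ / 2) (2 * n + 1) x y) ∧
      (s.card : ℝ) ≤ Real.exp (b * (2 * n + 1 : ℕ)) := by
    intro n
    by_cases hn : n₀ ≤ n
    · obtain ⟨s, hs⟩ := hn₀ n hn
      exact ⟨s, fun _ => hs⟩
    · exact ⟨∅, fun h => absurd h hn⟩
  choose F hF using hn₁
  set D : ℕ → ℝ := fun n => 2 * A * ρ * S.lam⁻¹ ^ n with hD
  have hDnn : ∀ n, 0 < D n := fun n => by simp only [hD]; positivity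
  set T : ∀ n : ℕ, F n → Set X := fun n y =>
    {x | OrbClose S.phi (ρ / 2) (2 * n + 1) (S.phi.symm^[n] x) y} with hT
  have hdiam : ∀ n, ∀ i, ediam (T n i) ≤ ENNReal.ofReal (D n) := by
    intro n i
    refine Metric.ediam_le fun x hx y hy => ?_
    rw [edist_dist]
    refine ENNReal.ofReal_le_ofReal ?_
    have := hC.expansive (x := S.phi.symm^[n] x) (y := S.phi.symm^[n] y) le_rfl n
      (fun j hj => by
        have t1 := hx j (by omega)
        have t2 := hy j (by omega)
        linarith [dist_triangle_right (S.phi^[j] (S.phi.symm^[n] x))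
          (S.phi^[j] (S.phi.symm^[n] y)) (S.phi^[j] i)])
    rwa [S.iter_symm, S.iter_symm] at this
  have hD0 : Filter.Tendsto (fun n => ENNReal.ofReal (D n)) Filter.atTop (𝓝 0) := by
    rw [← ENNReal.ofReal_zero]
    refine ENNReal.tendsto_ofReal ?_
    have := (tendsto_pow_atTop_nhds_zero_of_lt_one hli.le
      (inv_lt_one_of_one_lt₀ S.one_lt_lam)).const_mul (2 * A * ρ)
    simpa [hD] using this
  have hle := Measure.hausdorffMeasure_le_liminf_sum s (Set.univ : Set X)
    (fun n => ENNReal.ofReal (D n)) hD0 T (Filter.Eventually.of_forall hdiam)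
    (by
      filter_upwards [Filter.eventually_ge_atTop n₀] with n hn
      intro x _
      obtain ⟨y, hy, hxy⟩ := (hF n hn).1 (S.phi.symm^[n] x)
      exact mem_iUnion.2 ⟨⟨y, hy⟩, hxy⟩)
  refine ne_top_of_le_ne_top (b := ENNReal.ofReal (Real.exp b * (2 * A * ρ) ^ s))
    ENNReal.ofReal_ne_top (hle.trans ?_)
  refine Filter.liminf_le_of_frequently_le' (Filter.Eventually.frequently ?_)
  filter_upwards [Filter.eventually_ge_atTop n₀] with n hn
  calc ∑ i, ediam (T n i) ^ s ≤ ∑ i : F n, ENNReal.ofReal (D n) ^ s :=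
        Finset.sum_le_sum fun i _ => ENNReal.rpow_le_rpow (hdiam n i) hs.le
    _ = ENNReal.ofReal ((F n).card * D n ^ s) := by
        rw [Finset.sum_const, Finset.card_univ, Fintype.card_coe, nsmul_eq_mul,
          ENNReal.ofReal_mul (Nat.cast_nonneg _), ENNReal.ofReal_natCast,
          ENNReal.ofReal_rpow_of_pos (hDnn n)]
    _ ≤ _ := by
        refine ENNReal.ofReal_le_ofReal ?_
        have h5 : D n ^ s = (2 * A * ρ) ^ s * Real.exp (-(2 * b * n)) := by
          simp only [hD]
          rw [Real.mul_rpow (by positivity) (by positivity)]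
          congr 1
          have : S.lam⁻¹ = Real.exp (-Real.log S.lam) := by
            rw [Real.exp_neg, Real.exp_log hlam0]
          rw [this, ← Real.exp_nat_mul, ← Real.exp_mul]
          congr 1
          rw [hb]; ring
        rw [h5]
        calc ((F n).card : ℝ) * ((2 * A * ρ) ^ s * Real.exp (-(2 * b * n)))
            ≤ Real.exp (b * (2 * n + 1 : ℕ)) * ((2 * A * ρ) ^ s * Real.exp (-(2 * b * n))) := by
              refine mul_le_mul_of_nonneg_right (hF n hn).2 (by positivity)
          _ = (Real.exp (b * (2 * n + 1 : ℕ)) * Real.exp (-(2 * b * n))) * (2 * A * ρ) ^ s := by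
              ring
          _ = Real.exp b * (2 * A * ρ) ^ s := by
              rw [← Real.exp_add]
              congr 2
              push_cast
              ring

end SmaleSpace

lemma lipConst_dist {X : Type*} [MetricSpace X] {f : X → X} {K : ℝ≥0∞} (hK : lipConst f ≤ K)
    (hK' : K ≠ ⊤) (x y : X) : dist (f x) (f y) ≤ K.toReal * dist x y := by
  have h1 : edist (f x) (f y) ≤ K * edist x y := by
    rcases eq_or_ne x y with rfl | hxy
    · simp
    have h0 : edist x y ≠ 0 := by simpa using hxy
    rw [← ENNReal.div_le_iff h0 (edist_ne_top _ _)]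
    refine le_trans ?_ hK
    refine le_sInf fun L hL => ?_
    rw [ENNReal.div_le_iff h0 (edist_ne_top _ _)]
    exact hL x y
  have h2 := ENNReal.toReal_mono (ENNReal.mul_ne_top hK' (edist_ne_top _ _)) h1
  rwa [ENNReal.toReal_mul, ← dist_edist, ← dist_edist] at h2

/-- Dimension estimates for mixing Smale spaces with bi-Lipschitz dynamics:
if `Λ_X = max{Lip φ, Lip φ⁻¹} < ∞`, the bracket satisfies
`d(x,[x,y]) ≤ A d(x,y)` and `d(y,[x,y]) ≤ A d(x,y)` for `d(x,y) ≤ ε₀`, and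
`λ_X > 2A`, then `2h(φ)/log Λ_X ≤ dim_H X ≤ 2h(φ)/(log λ_X − log 2A)`. -/
theorem mixing_smale_space_dimH_bounds {X : Type*} [MetricSpace X]
    [CompactSpace X] (S : SmaleSpace X) (hmix : MixingSystem ⇑S.phi)
    (hΛfin : max (lipConst ⇑S.phi) (lipConst ⇑S.phi.symm) ≠ ⊤)
    (A ε₀ : ℝ) (hA : 0 < A) (hε₀ : 0 < ε₀)
    (hbr : ∀ x y : X, dist x y ≤ ε₀ →
      dist x (S.bracket x y) ≤ A * dist x y ∧
      dist y (S.bracket x y) ≤ A * dist x y)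
    (hlam : 2 * A < S.lam)
    (h : ℝ) (hent : Dynamics.coverEntropy ⇑S.phi Set.univ = (h : EReal)) :
    ENNReal.ofReal (2 * h /
        Real.log (max (lipConst ⇑S.phi) (lipConst ⇑S.phi.symm)).toReal) ≤
      dimH (Set.univ : Set X) ∧
    dimH (Set.univ : Set X) ≤
      ENNReal.ofReal (2 * h / (Real.log S.lam - Real.log (2 * A))) := by
  borelize X
  have hne : Nonempty X := by
    by_contra hcon
    rw [not_nonempty_iff] at hcon
    have hE : (Set.univ : Set X) = ∅ := Set.univ_eq_empty_iff.2 hcon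
    rw [hE, Dynamics.coverEntropy_empty] at hent
    exact absurd hent.symm (EReal.coe_ne_bot h)
  have hh : 0 ≤ h := by
    have := Dynamics.coverEntropy_nonneg ⇑S.phi (Set.univ_nonempty (α := X))
    rw [hent] at this
    exact_mod_cast this
  have hC : S.Ctrl (max A 1) (min ε₀ (S.eps / (2 * max A 1))) := by
    have h1 : (1 : ℝ) ≤ max A 1 := le_max_right _ _
    have he := S.eps_pos
    have h2 : min ε₀ (S.eps / (2 * max A 1)) ≤ S.eps / (2 * max A 1) := min_le_right _ _
    have h3 : max A 1 * (S.eps / (2 * max A 1)) = S.eps / 2 := by field_simp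
    have h4 : max A 1 * min ε₀ (S.eps / (2 * max A 1)) ≤ S.eps / 2 := by
      rw [← h3]
      exact mul_le_mul_of_nonneg_left h2 (by linarith)
    refine ⟨h1, by positivity, ?_, by linarith, fun x y hxy => ?_⟩
    · refine h2.trans (div_le_self he.le (by linarith))
    · obtain ⟨h5, h6⟩ := hbr x y (hxy.trans (min_le_left _ _))
      have h7 : A * dist x y ≤ max A 1 * dist x y :=
        mul_le_mul_of_nonneg_right (le_max_left _ _) dist_nonneg
      exact ⟨h5.trans h7, h6.trans h7⟩
  constructor
  · set L := (max (lipConst ⇑S.phi) (lipConst ⇑S.phi.symm)).toReal with hL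
    rcases le_or_gt L 1 with hL1 | hL1
    · rw [ENNReal.ofReal_of_nonpos]
      · exact zero_le
      · exact div_nonpos_of_nonneg_of_nonpos (by linarith)
          (Real.log_nonpos ENNReal.toReal_nonneg hL1)
    · have hlog : 0 < Real.log L := Real.log_pos hL1
      refine le_of_forall_lt fun d hd => ?_
      obtain ⟨s, hds, hs⟩ := ENNReal.lt_iff_exists_nnreal_btwn.1 hd
      refine hds.trans_le ?_
      have hs0 : 0 < (s : ℝ) := by
        have := pos_of_gt hds
        exact_mod_cast this
      have hs2 : (s : ℝ) < 2 * h / Real.log L := by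
        rw [← ENNReal.ofReal_coe_nnreal] at hs
        exact (ENNReal.ofReal_lt_ofReal_iff_of_nonneg s.2).1 hs
      rw [lt_div_iff₀ hlog] at hs2
      exact le_dimH_of_hausdorffMeasure_ne_zero (hC.lower_dim hmix hent hL1
        (fun x y => lipConst_dist (le_max_left _ _) hΛfin x y)
        (fun x y => lipConst_dist (le_max_right _ _) hΛfin x y) hs0 (by linarith))
  · rcases lt_or_ge (2 * A) 1 with hA1 | hA1
    · have hdisc : ∀ x y : X, dist x y ≤ ε₀ → x = y := by
        intro x y hxy
        obtain ⟨h5, h6⟩ := hbr x y hxy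
        have h7 := dist_triangle_right x y (S.bracket x y)
        have h8 : dist x y ≤ 0 := by nlinarith [dist_nonneg (x := x) (y := y)]
        exact dist_le_zero.1 h8
      have hfin : (Set.univ : Set X).Finite := by
        obtain ⟨t, -, ht, hcov⟩ := (isCompact_univ (X := X)).finite_cover_balls hε₀
        refine ht.subset fun x hx => ?_
        obtain ⟨a, ha, hxa⟩ := mem_iUnion₂.1 (hcov hx)
        rw [hdisc x a (mem_ball.1 hxa).le]
        exact ha
      rw [hfin.dimH_zero]
      exact zero_le
    · have hl0 : 0 < Real.log S.lam - Real.log (2 * A) :=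
        sub_pos.2 (Real.log_lt_log (by linarith) hlam)
      have hl1 : 0 ≤ Real.log (2 * A) := Real.log_nonneg hA1
      refine le_of_forall_gt fun d hd => ?_
      obtain ⟨s, hs, hsd⟩ := ENNReal.lt_iff_exists_nnreal_btwn.1 hd
      refine lt_of_le_of_lt ?_ hsd
      have hs2 : 2 * h / (Real.log S.lam - Real.log (2 * A)) < (s : ℝ) := by
        rw [← ENNReal.ofReal_coe_nnreal] at hs
        exact (ENNReal.ofReal_lt_ofReal_iff_of_nonneg (by positivity)).1 hs
      have hs0 : 0 < (s : ℝ) := lt_of_le_of_lt (by positivity) hs2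
      rw [div_lt_iff₀ hl0] at hs2
      have : 0 ≤ (s : ℝ) * Real.log (2 * A) := by positivity
      exact dimH_le_of_hausdorffMeasure_ne_top (hC.upper_dim hent hs0 (by linarith))
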